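/- arXiv:1212.3589 — 6 statements merged into one kernel-verified Lean document; each statement's English description precedes it below -/
import Mathlib

section
/- Let N > 1 be a natural number and let H be an N×N circulant matrix with all entries in {−1, 1} whose rows are pairwise orthogonal (i.e. H·Hᵀ = N·I_N). Then N = 4n² for some positive integer n. -/
open Matrix

theorem circulant_hadamard_size (N : ℕ) [NeZero N] (hN : 1 < N)
    (H : Matrix (ZMod N) (ZMod N) ℤ)
    (hentries : ∀ i j, H i j = 1 ∨ H i j = -1)
    (hcirc : ∃ ξ : ZMod N → ℤ, ∀ i j, H i j = ξ (j - i))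
    (horth : H * Hᵀ = (N : ℤ) • (1 : Matrix (ZMod N) (ZMod N) ℤ)) :
    ∃ n : ℕ, 0 < n ∧ N = 4 * n ^ 2 := by
  obtain ⟨ξ, hξ⟩ := hcirc
  haveI : Fact (1 < N) := ⟨hN⟩
  have hent : ∀ j, ∑ k, H 0 k * H j k = if (0 : ZMod N) = j then (N : ℤ) else 0 := by
    intro j
    have h := congrFun (congrFun horth 0) j
    simpa [Matrix.mul_apply, Matrix.one_apply] using h
  have hs : (∑ k, ξ k) * (∑ k, ξ k) = (N : ℤ) := by
    have h1 : ∑ j, ∑ k, H 0 k * H j k = (N : ℤ) := by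
      simp [hent]
    rw [← h1, Finset.sum_comm, Finset.sum_mul]
    refine Finset.sum_congr rfl fun k _ => ?_
    rw [← Finset.mul_sum, hξ 0 k, sub_zero]
    congr 1
    rw [← Equiv.sum_comp (Equiv.subLeft k) ξ]
    refine Finset.sum_congr rfl fun j _ => ?_
    rw [hξ]; rfl
  have h0 : ∑ k, H 0 k * H 1 k = 0 := by
    rw [hent 1, if_neg zero_ne_one]
  have heven : (N : ZMod 2) = 0 := by
    have h2 := congrArg (Int.cast : ℤ → ZMod 2) h0
    have h3 : ∀ i j, ((H i j : ℤ) : ZMod 2) = 1 := by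
      intro i j
      rcases hentries i j with h | h <;> rw [h] <;> decide
    simpa [h3] using h2
  have hNe : Even N := (ZMod.natCast_eq_zero_iff_even).1 heven
  have hse : Even (∑ k, ξ k) := by
    have : Even ((∑ k, ξ k) * (∑ k, ξ k)) := by rw [hs]; exact_mod_cast hNe
    rcases Int.even_mul.1 this with h | h <;> exact h
  obtain ⟨m, hm⟩ := hse
  have hfin : (N : ℤ) = 4 * (m.natAbs : ℤ) ^ 2 := by
    rw [← hs, hm, Int.natAbs_sq]; ring
  have hfin' : N = 4 * m.natAbs ^ 2 := by exact_mod_cast hfin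
  refine ⟨m.natAbs, ?_, hfin'⟩
  rcases Nat.eq_zero_or_pos m.natAbs with h | h
  · rw [h] at hfin'; omega
  · exact h
end

section
/- Let l = p^a q^b where p and q are primes and a, b ≥ 0 are natural numbers. If λ_1, …, λ_N are l-th roots of unity (a finite multiset, N ≥ 0) with λ_1 + ⋯ + λ_N = 0, then the multiset {λ_1, …, λ_N} can be partitioned into sub-multisets each of which is a full cycle, i.e. each sub-multiset has the form {λ, λω, λω², …, λω^{r−1}} where r ∈ {p, q} is a prime dividing l, ω = e^{2πi/r}, and λ is an l-th root of unity. -/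
/-- A multiset of powers of `ζ` is the evaluation of an integer polynomial. -/
lemma vs_exists_poly (l : ℕ) (hl : l ≠ 0) (ζ : ℂ) (hζ : IsPrimitiveRoot ζ l)
    (S : Multiset ℂ) (hroots : ∀ z ∈ S, z ^ l = 1) :
    ∃ F : Polynomial ℤ, ∀ k : ℕ, Polynomial.aeval (ζ ^ k) F = (S.map (fun z => z ^ k)).sum := by
  induction S using Multiset.induction_on with
  | empty => exact ⟨0, by simp⟩
  | cons z S ih =>
    obtain ⟨F, hF⟩ := ih (fun y hy => hroots y (Multiset.mem_cons_of_mem hy))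
    haveI : NeZero l := ⟨hl⟩
    obtain ⟨i, -, hi⟩ := hζ.eq_pow_of_pow_eq_one (hroots z (Multiset.mem_cons_self z S))
    refine ⟨Polynomial.X ^ i + F, fun k => ?_⟩
    simp only [map_add, map_pow, Polynomial.aeval_X, hF, Multiset.map_cons, Multiset.sum_cons, ← hi]
    ring

/-- Galois conjugation. -/
lemma vs_psum_coprime (l : ℕ) (hl : l ≠ 0) (S : Multiset ℂ) (hroots : ∀ z ∈ S, z ^ l = 1)
    (hsum : S.sum = 0) (k : ℕ) (hk : Nat.Coprime k l) : (S.map (fun z => z ^ k)).sum = 0 := by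
  have hζ := Complex.isPrimitiveRoot_exp l hl
  obtain ⟨F, hF⟩ := vs_exists_poly l hl _ hζ S hroots
  have h1 := hF 1
  simp only [pow_one, Multiset.map_id', hsum] at h1
  have hd := minpoly.isIntegrallyClosed_dvd (hζ.isIntegral (Nat.pos_of_ne_zero hl)) h1
  rw [hζ.minpoly_eq_pow_coprime hk] at hd
  rw [← hF k]
  obtain ⟨G, hG⟩ := hd
  rw [hG, map_mul, minpoly.aeval, zero_mul]

/-- Power sums determine a multiset. -/
lemma vs_ext_psum (A B : Multiset ℂ)
    (h : ∀ k : ℕ, (A.map (fun z => z ^ k)).sum = (B.map (fun z => z ^ k)).sum) : A = B := by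
  classical
  have hP : ∀ P : Polynomial ℂ, (A.map (fun z => P.eval z)).sum = (B.map (fun z => P.eval z)).sum := by
    intro P
    induction P using Polynomial.induction_on' with
    | add P Q hp hq => simp [Multiset.sum_map_add, hp, hq]
    | monomial n c => simp [Multiset.sum_map_mul_left, h]
  ext x
  let P : Polynomial ℂ := ∏ y ∈ (A + B).toFinset.erase x, (Polynomial.X - Polynomial.C y)
  have hx : P.eval x ≠ 0 := by
    simp only [P, Polynomial.eval_prod, Finset.prod_ne_zero_iff]
    intro y hy
    have := Finset.ne_of_mem_erase hy
    simpa [sub_eq_zero] using this.symm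
  have key : ∀ D : Multiset ℂ, D ≤ A + B →
      (D.map (fun z => P.eval z)).sum = D.count x * P.eval x := by
    intro D hD
    rw [← nsmul_eq_mul, ← Multiset.sum_map_eq_nsmul_single (m := D) (f := fun z => P.eval z) x]
    intro y hy hyD
    simp only [P, Polynomial.eval_prod]
    refine Finset.prod_eq_zero (i := y) ?_ (by simp)
    exact Finset.mem_erase.2 ⟨hy, Multiset.mem_toFinset.2 (Multiset.mem_of_le hD hyD)⟩
  have := hP P
  rw [key A (Multiset.le_add_right _ _), key B (Multiset.le_add_left _ _)] at this
  exact_mod_cast mul_right_cancel₀ hx this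

lemma vs_rect (l : ℕ) (hl : l ≠ 0) (S : Multiset ℂ) (hroots : ∀ z ∈ S, z ^ l = 1)
    (hsum : S.sum = 0) (α β : ℂ)
    (H : ∀ k : ℕ, ¬ Nat.Coprime k l → α ^ k = 1 ∨ β ^ k = 1) :
    S + S.map (fun z => α * β * z) = S.map (fun z => α * z) + S.map (fun z => β * z) := by
  apply vs_ext_psum
  intro k
  simp only [Multiset.map_add, Multiset.map_map, Function.comp_def, mul_pow, Multiset.sum_add,
    Multiset.sum_map_mul_left]
  by_cases hk : Nat.Coprime k l
  · simp [vs_psum_coprime l hl S hroots hsum k hk]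
  · rcases H k hk with h | h <;> rw [h] <;> ring

lemma vs_count (S : Multiset ℂ) (α x : ℂ) (hα : α ≠ 0) :
    (S.map (fun z => α * z)).count (α * x) = S.count x :=
  Multiset.count_map_eq_count' _ _ (mul_right_injective₀ hα) _

lemma vs_cycle_le (S : Multiset ℂ) (r : ℕ) (hr : r ≠ 0) (lam : ℂ) (h0 : lam ≠ 0)
    (h : ∀ t : ℕ, lam * Complex.exp (2 * Real.pi * Complex.I / r) ^ t ∈ S) :
    Multiset.map (fun t : ℕ => lam * Complex.exp (2 * Real.pi * Complex.I / r) ^ t)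
              (Multiset.range r) ≤ S := by
  rw [Multiset.le_iff_subset]
  · intro z hz
    obtain ⟨t, -, rfl⟩ := Multiset.mem_map.1 hz
    exact h t
  · refine Multiset.Nodup.map_on ?_ (Multiset.nodup_range r)
    intro i hi j hj hij
    exact (Complex.isPrimitiveRoot_exp r hr).pow_inj (Multiset.mem_range.1 hi)
      (Multiset.mem_range.1 hj) (mul_left_cancel₀ h0 hij)

lemma vs_prime_power (p n : ℕ) (hp : p.Prime) (S : Multiset ℂ)
    (hroots : ∀ z ∈ S, z ^ (p ^ n) = 1) (hsum : S.sum = 0) (hS : S ≠ 0) :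
    p ∣ p ^ n ∧ ∃ x ∈ S, ∀ t : ℕ, x * Complex.exp (2 * Real.pi * Complex.I / p) ^ t ∈ S := by
  classical
  have hω := Complex.isPrimitiveRoot_exp p hp.ne_zero
  have hω0 : Complex.exp (2 * Real.pi * Complex.I / p) ≠ 0 := Complex.exp_ne_zero _
  set ω := Complex.exp (2 * Real.pi * Complex.I / p)
  have hl : p ^ n ≠ 0 := pow_ne_zero _ hp.ne_zero
  refine ⟨?_, ?_⟩
  · rcases Nat.eq_zero_or_pos n with rfl | hn
    · exfalso
      have : S = Multiset.replicate S.card 1 :=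
        Multiset.eq_replicate_card.2 (fun z hz => by simpa using hroots z hz)
      rw [this] at hsum
      simp at hsum
      exact hS hsum
    · exact dvd_pow_self p hn.ne'
  · obtain ⟨y, hy⟩ := Multiset.exists_mem_of_ne_zero hS
    obtain ⟨x, hx, hmax⟩ := S.toFinset.exists_max_image (fun z => S.count z)
      ⟨y, Multiset.mem_toFinset.2 hy⟩
    rw [Multiset.mem_toFinset] at hx
    have hmax' : ∀ z, S.count z ≤ S.count x := by
      intro z
      by_cases hz : z ∈ S
      · exact hmax z (Multiset.mem_toFinset.2 hz)
      · simp [Multiset.count_eq_zero_of_notMem hz]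
    refine ⟨x, hx, fun t => ?_⟩
    have ha0 : ω ^ t ≠ 0 := pow_ne_zero _ hω0
    have hrect := vs_rect (p ^ n) hl S hroots hsum (ω ^ t) (ω ^ t)⁻¹ (by
      intro k hk
      left
      have hpk : p ∣ k := by
        by_contra hpk
        exact hk (Nat.Coprime.pow_right n ((Nat.Prime.coprime_iff_not_dvd hp).2 hpk).symm)
      obtain ⟨c, rfl⟩ := hpk
      rw [← pow_mul, mul_left_comm, pow_mul, hω.pow_eq_one, one_pow])
    have hc := congrArg (Multiset.count x) hrect
    simp only [mul_inv_cancel₀ ha0, one_mul, Multiset.map_id', Multiset.count_add] at hc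
    have e1 := vs_count S (ω ^ t) ((ω ^ t)⁻¹ * x) ha0
    have e2 := vs_count S (ω ^ t)⁻¹ (ω ^ t * x) (inv_ne_zero ha0)
    rw [mul_inv_cancel_left₀ ha0] at e1
    rw [inv_mul_cancel_left₀ ha0] at e2
    rw [e1, e2] at hc
    have h1 := hmax' ((ω ^ t)⁻¹ * x)
    have h2 := Multiset.count_pos.2 hx
    rw [mul_comm, ← Multiset.count_pos]
    omega

lemma vs_two_primes (p q a b : ℕ) (hp : p.Prime) (hq : q.Prime)
    (S : Multiset ℂ) (hroots : ∀ z ∈ S, z ^ (p ^ a * q ^ b) = 1) (hsum : S.sum = 0) (hS : S ≠ 0) :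
    ∃ x ∈ S, (∀ t : ℕ, x * Complex.exp (2 * Real.pi * Complex.I / p) ^ t ∈ S) ∨
      (∀ t : ℕ, x * Complex.exp (2 * Real.pi * Complex.I / q) ^ t ∈ S) := by
  classical
  have hω := Complex.isPrimitiveRoot_exp p hp.ne_zero
  have hω0 : Complex.exp (2 * Real.pi * Complex.I / p) ≠ 0 := Complex.exp_ne_zero _
  set ω := Complex.exp (2 * Real.pi * Complex.I / p)
  have hη := Complex.isPrimitiveRoot_exp q hq.ne_zero
  have hη0 : Complex.exp (2 * Real.pi * Complex.I / q) ≠ 0 := Complex.exp_ne_zero _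
  set η := Complex.exp (2 * Real.pi * Complex.I / q)
  have hl : p ^ a * q ^ b ≠ 0 := mul_ne_zero (pow_ne_zero _ hp.ne_zero) (pow_ne_zero _ hq.ne_zero)
  obtain ⟨x, hx⟩ := Multiset.exists_mem_of_ne_zero hS
  refine ⟨x, hx, ?_⟩
  by_contra! hcon
  obtain ⟨⟨s, hs⟩, ⟨t, ht⟩⟩ := hcon
  have ha0 : ω ^ s ≠ 0 := pow_ne_zero _ hω0
  have hb0 : η ^ t ≠ 0 := pow_ne_zero _ hη0
  have hrect := vs_rect _ hl S hroots hsum (ω ^ s) (η ^ t) (by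
    intro k hk
    have hpk : p ∣ k ∨ q ∣ k := by
      by_contra! hpk
      exact hk (Nat.Coprime.mul_right
        (Nat.Coprime.pow_right a ((Nat.Prime.coprime_iff_not_dvd hp).2 hpk.1).symm)
        (Nat.Coprime.pow_right b ((Nat.Prime.coprime_iff_not_dvd hq).2 hpk.2).symm))
    rcases hpk with ⟨c, rfl⟩ | ⟨c, rfl⟩
    · left
      rw [← pow_mul, mul_left_comm, pow_mul, hω.pow_eq_one, one_pow]
    · right
      rw [← pow_mul, mul_left_comm, pow_mul, hη.pow_eq_one, one_pow])
  have hc := congrArg (Multiset.count (ω ^ s * η ^ t * x)) hrect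
  simp only [Multiset.count_add] at hc
  rw [vs_count S _ x (mul_ne_zero ha0 hb0)] at hc
  have e1 := vs_count S (ω ^ s) (η ^ t * x) ha0
  have e2 := vs_count S (η ^ t) (ω ^ s * x) hb0
  rw [← mul_assoc] at e1
  rw [← mul_assoc, mul_comm (η ^ t)] at e2
  rw [e1, e2, mul_comm (η ^ t), mul_comm (ω ^ s) x, Multiset.count_eq_zero_of_notMem hs,
    Multiset.count_eq_zero_of_notMem ht] at hc
  have h2 := Multiset.count_pos.2 hx
  omega

lemma vs_exists_cycle
    (p q a b l : ℕ) (hp : p.Prime) (hq : q.Prime) (hl : l = p ^ a * q ^ b)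
    (S : Multiset ℂ) (hroots : ∀ z ∈ S, z ^ l = 1) (hsum : S.sum = 0) (hS : S ≠ 0) :
    ∃ (r : ℕ) (lam : ℂ), (r = p ∨ r = q) ∧ r ∣ l ∧ lam ∈ S ∧
      ∀ t : ℕ, lam * Complex.exp (2 * Real.pi * Complex.I / r) ^ t ∈ S := by
  rcases Nat.eq_zero_or_pos a with rfl | ha
  · rw [pow_zero, one_mul] at hl
    subst hl
    obtain ⟨h1, x, hx, h⟩ := vs_prime_power q b hq S hroots hsum hS
    exact ⟨q, x, Or.inr rfl, h1, hx, h⟩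
  rcases Nat.eq_zero_or_pos b with rfl | hb
  · rw [pow_zero, mul_one] at hl
    subst hl
    obtain ⟨h1, x, hx, h⟩ := vs_prime_power p a hp S hroots hsum hS
    exact ⟨p, x, Or.inl rfl, h1, hx, h⟩
  subst hl
  obtain ⟨x, hx, h | h⟩ := vs_two_primes p q a b hp hq S hroots hsum hS
  · exact ⟨p, x, Or.inl rfl, (dvd_pow_self p ha.ne').mul_right _, hx, h⟩
  · exact ⟨q, x, Or.inr rfl, (dvd_pow_self q hb.ne').mul_left _, hx, h⟩

/-- If `l = p^a * q^b` with `p, q` prime and a multiset of `l`-th roots of unity sums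
to zero, then it splits as a disjoint union of full cycles. -/
theorem vanishing_sum_two_primes_splits_into_cycles
    (p q a b l : ℕ) (hp : p.Prime) (hq : q.Prime) (hl : l = p ^ a * q ^ b)
    (S : Multiset ℂ) (hroots : ∀ z ∈ S, z ^ l = 1) (hsum : S.sum = 0) :
    ∃ C : Multiset (Multiset ℂ), S = C.sum ∧
      ∀ T ∈ C, ∃ (r : ℕ) (lam : ℂ), (r = p ∨ r = q) ∧ r ∣ l ∧ lam ^ l = 1 ∧
        T = Multiset.map (fun t : ℕ => lam * Complex.exp (2 * Real.pi * Complex.I / r) ^ t)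
              (Multiset.range r) := by
  induction S using Multiset.strongInductionOn with
  | ih S ih =>
    by_cases hS : S = 0
    · exact ⟨0, by simp [hS]⟩
    obtain ⟨r, lam, hr, hrl, hlam, hmem⟩ := vs_exists_cycle p q a b l hp hq hl S hroots hsum hS
    have hrp : r.Prime := by rcases hr with rfl | rfl <;> assumption
    have hl0 : l ≠ 0 := by
      rw [hl]
      exact mul_ne_zero (pow_ne_zero _ hp.ne_zero) (pow_ne_zero _ hq.ne_zero)
    have h0 : lam ≠ 0 := by
      rintro rfl
      simpa [hl0] using hroots 0 hlam
    have hle := vs_cycle_le S r hrp.ne_zero lam h0 hmem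
    obtain ⟨R, hR⟩ := Multiset.le_iff_exists_add.1 hle
    have hTsum : (Multiset.map (fun t : ℕ => lam * Complex.exp (2 * Real.pi * Complex.I / r) ^ t)
              (Multiset.range r)).sum = 0 := by
      rw [Multiset.sum_map_mul_left]
      have := (Complex.isPrimitiveRoot_exp r hrp.ne_zero).geom_sum_eq_zero hrp.one_lt
      rw [Finset.sum, Finset.range_val] at this
      rw [this, mul_zero]
    have hTne : (Multiset.map (fun t : ℕ => lam * Complex.exp (2 * Real.pi * Complex.I / r) ^ t)
              (Multiset.range r)) ≠ 0 := by
      intro h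
      have := congrArg Multiset.card h
      simp at this
      exact hrp.ne_zero this
    have hlt : R < S := by
      rw [hR]
      exact lt_add_of_pos_left _ (pos_iff_ne_zero.2 hTne)
    obtain ⟨C, hC, hC'⟩ := ih R hlt (fun z hz => hroots z (Multiset.mem_of_le hlt.le hz)) (by
      rw [hR, Multiset.sum_add, hTsum, zero_add] at hsum
      exact hsum)
    refine ⟨_ ::ₘ C, by rw [Multiset.sum_cons, ← hC]; exact hR, ?_⟩
    intro T hT
    rcases Multiset.mem_cons.1 hT with rfl | hT
    · exact ⟨r, lam, hr, hrl, hroots lam hlam, rfl⟩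
    · exact hC' T hT
end

section
/- (Lam–Leung) Let l ≥ 1 have prime factorization l = p_1^{a_1} ⋯ p_k^{a_k}, and let λ_1, …, λ_N be l-th roots of unity, N ≥ 1, with λ_1 + λ_2 + ⋯ + λ_N = 0. Then there exist nonnegative integers c_1, …, c_k such that N = c_1 p_1 + c_2 p_2 + ⋯ + c_k p_k. -/
/-- Splitting a multiset of `n * P`-th roots of unity according to the cosets of the group of
`n`-th roots of unity. -/
lemma ll_decomp (n P : ℕ) (hn : n ≠ 0) (hP : 0 < P) (ζ : ℂ) (hζ : IsPrimitiveRoot (ζ ^ n) P)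
    (x : Multiset ℂ) (hx : ∀ z ∈ x, z ^ (n * P) = 1) :
    ∃ X : ℕ → Multiset ℂ, (∀ j, ∀ z ∈ X j, z ^ n = 1) ∧
      x.card = ∑ j ∈ Finset.range P, (X j).card ∧
      x.sum = ∑ j ∈ Finset.range P, ζ ^ j * (X j).sum := by
  classical
  induction x using Multiset.induction_on with
  | empty => exact ⟨fun _ => 0, by simp, by simp, by simp⟩
  | cons a x ih =>
    obtain ⟨X, h1, h2, h3⟩ := ih (fun z hz => hx z (Multiset.mem_cons_of_mem hz))
    have ha := hx a (Multiset.mem_cons_self a x)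
    rw [pow_mul] at ha
    have : NeZero P := ⟨hP.ne'⟩
    obtain ⟨i, hi, hia⟩ := hζ.eq_pow_of_pow_eq_one ha
    have hne : ζ ^ n ≠ 0 := hζ.ne_zero hP.ne'
    have hne' : (ζ ^ i) ^ n ≠ 0 := by
      rw [← pow_mul, mul_comm, pow_mul]; exact pow_ne_zero _ hne
    have hz : ζ ^ i ≠ 0 := fun h => hne' (by rw [h, zero_pow hn])
    refine ⟨Function.update X i ((a / ζ ^ i) ::ₘ X i), ?_, ?_, ?_⟩
    · intro j z hz
      by_cases hj : j = i
      · subst hj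
        simp only [Function.update_self, Multiset.mem_cons] at hz
        rcases hz with rfl | hz
        · rw [div_pow, div_eq_one_iff_eq hne', ← hia, ← pow_mul, ← pow_mul, mul_comm]
        · exact h1 _ _ hz
      · rw [Function.update_of_ne hj] at hz
        exact h1 _ _ hz
    · rw [Multiset.card_cons, h2, ← Finset.add_sum_erase _ _ (Finset.mem_range.2 hi),
        ← Finset.add_sum_erase _ _ (Finset.mem_range.2 hi), Function.update_self,
        Multiset.card_cons]
      have he : ∑ j ∈ (Finset.range P).erase i,
          (Function.update X i ((a / ζ ^ i) ::ₘ X i) j).card =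
          ∑ j ∈ (Finset.range P).erase i, (X j).card := by
        refine Finset.sum_congr rfl ?_
        intro j hj
        rw [Function.update_of_ne (Finset.ne_of_mem_erase hj)]
      rw [he]
      ring
    · rw [Multiset.sum_cons, h3, ← Finset.add_sum_erase _ _ (Finset.mem_range.2 hi),
        ← Finset.add_sum_erase (a := i) _ _ (Finset.mem_range.2 hi), Function.update_self,
        Multiset.sum_cons]
      have he : ∑ j ∈ (Finset.range P).erase i,
          ζ ^ j * (Function.update X i ((a / ζ ^ i) ::ₘ X i) j).sum =
          ∑ j ∈ (Finset.range P).erase i, ζ ^ j * (X j).sum := by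
        refine Finset.sum_congr rfl ?_
        intro j hj
        rw [Function.update_of_ne (Finset.ne_of_mem_erase hj)]
      rw [he, mul_add, mul_div_cancel₀ _ hz]
      ring

open IntermediateField in
/-- The degree of `ζ` over the `n`-th cyclotomic field. -/
lemma ll_degree (n m : ℕ) (hn : 0 < n) (hm : 0 < m) (ξ ζ θ : ℂ) (hξ : IsPrimitiveRoot ξ n)
    (hθ : IsPrimitiveRoot θ m) (hζ : IsIntegral ℚ ζ)
    (hmem : ∃ a : ℕ, θ = ξ ^ a * ζ) :
    m.totient ≤ n.totient * (minpoly ℚ⟮ξ⟯ ζ).natDegree := by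
  have key : ∀ (k : ℕ) (w : ℂ), 0 < k → IsPrimitiveRoot w k →
      Module.finrank ℚ ℚ⟮w⟯ = k.totient ∧ IsIntegral ℚ w := by
    intro k w hk hw
    have hi : IsIntegral ℚ w := (hw.isIntegral hk).tower_top
    refine ⟨?_, hi⟩
    rw [adjoin.finrank hi, ← Polynomial.cyclotomic_eq_minpoly_rat hw hk,
      Polynomial.natDegree_cyclotomic]
  obtain ⟨h1, i1⟩ := key n ξ hn hξ
  obtain ⟨h2, i2⟩ := key m θ hm hθ
  have hζ' : IsIntegral ℚ⟮ξ⟯ ζ := hζ.tower_top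
  have : FiniteDimensional ℚ ℚ⟮ξ⟯ := adjoin.finiteDimensional i1
  have : FiniteDimensional ℚ⟮ξ⟯ ℚ⟮ξ⟯⟮ζ⟯ := adjoin.finiteDimensional hζ'
  have : FiniteDimensional ℚ ℚ⟮ξ⟯⟮ζ⟯ := FiniteDimensional.trans ℚ ℚ⟮ξ⟯ ℚ⟮ξ⟯⟮ζ⟯
  have h3 : Module.finrank ℚ ℚ⟮ξ⟯ * Module.finrank ℚ⟮ξ⟯ ℚ⟮ξ⟯⟮ζ⟯ = Module.finrank ℚ ℚ⟮ξ⟯⟮ζ⟯ :=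
    Module.finrank_mul_finrank _ _ _
  rw [h1, adjoin.finrank hζ'] at h3
  rw [h3, ← h2]
  have : FiniteDimensional ℚ (restrictScalars ℚ ℚ⟮ξ⟯⟮ζ⟯) := this
  have hle : ℚ⟮θ⟯ ≤ restrictScalars ℚ ℚ⟮ξ⟯⟮ζ⟯ := by
    rw [adjoin_simple_le_iff, mem_restrictScalars]
    obtain ⟨a, rfl⟩ := hmem
    refine mul_mem (pow_mem ?_ _) (mem_adjoin_simple_self _ _)
    exact IntermediateField.algebraMap_mem ℚ⟮ξ⟯⟮ζ⟯ (⟨ξ, mem_adjoin_simple_self _ _⟩ : ℚ⟮ξ⟯)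
  exact finrank_le_of_le_right hle

/-- Linear independence of small powers. -/
lemma ll_indep (K : IntermediateField ℚ ℂ) (ζ : ℂ) (d : ℕ) (hd : d ≤ (minpoly K ζ).natDegree)
    (a : ℕ → ℂ) (ha : ∀ j, a j ∈ K) (h : ∑ j ∈ Finset.range d, ζ ^ j * a j = 0) :
    ∀ j < d, a j = 0 := by
  classical
  set f : Polynomial K := ∑ j ∈ Finset.range d, Polynomial.monomial j (⟨a j, ha j⟩ : K) with hf
  have hfe : Polynomial.aeval ζ f = 0 := by
    rw [hf, map_sum, ← h]
    refine Finset.sum_congr rfl fun j _ => ?_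
    rw [Polynomial.aeval_monomial, mul_comm]
    rfl
  have hcoef : ∀ j < d, f.coeff j = ⟨a j, ha j⟩ := by
    intro j hj
    rw [hf, Polynomial.finsetSum_coeff]
    simp [Polynomial.coeff_monomial, hj]
  have hdeg : f.degree < d := by
    rw [Polynomial.degree_lt_iff_coeff_zero]
    intro m hm
    rw [hf, Polynomial.finsetSum_coeff]
    refine Finset.sum_eq_zero fun j hj => ?_
    rw [Polynomial.coeff_monomial, if_neg]
    have := Finset.mem_range.1 hj
    omega
  have hf0 : f = 0 := by
    by_contra hne
    have h1 := minpoly.degree_le_of_ne_zero K ζ hne hfe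
    have h2 : (d : WithBot ℕ) ≤ (minpoly K ζ).degree := by
      have : minpoly K ζ ≠ 0 := by
        intro h0
        rw [h0] at h1
        have : f.natDegree < d := (Polynomial.natDegree_lt_iff_degree_lt hne).2 hdeg
        rw [h0] at hd
        simp at hd
        omega
      rw [Polynomial.degree_eq_natDegree this]
      exact_mod_cast hd
    exact absurd (h2.trans h1) (not_le.2 hdeg)
  intro j hj
  have := hcoef j hj
  rw [hf0, Polynomial.coeff_zero] at this
  exact (congrArg Subtype.val this).symm

lemma ll_arith (p q P F fj a b u : ℕ) (hpq : p < q) (hqP : q ≤ P) (hab : a + b < p)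
    (h1 : u * (P - 1) ≤ F + u * a) (h2 : (p - (b + u)) * (q - 1) ≤ fj) :
    (p - (a + b)) * (q - 1) ≤ fj + F := by
  have h1' : u * (q - 1) ≤ F + u * a := le_trans (Nat.mul_le_mul_left _ (by omega)) h1
  obtain ⟨Q, rfl⟩ : ∃ Q, q = Q + 1 := ⟨q - 1, by omega⟩
  simp only [Nat.add_sub_cancel] at *
  obtain ⟨c, rfl⟩ : ∃ c, p = a + b + c := ⟨p - (a + b), by omega⟩
  rw [Nat.add_sub_cancel_left]
  by_cases hu : b + u ≤ a + b + c
  · obtain ⟨d, hd⟩ : ∃ d, a + c = u + d := ⟨a + c - u, by omega⟩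
    have : a + b + c - (b + u) = d := by omega
    rw [this] at h2
    have h4 : u ≤ Q := by omega
    have h5 : u * a ≤ Q * a := Nat.mul_le_mul_right _ h4
    nlinarith
  · have h4 : a + c ≤ u := by omega
    obtain ⟨e, rfl⟩ : ∃ e, Q = a + c + e := ⟨Q - (a + c), by omega⟩
    have : (a + c) * (c + e) ≤ u * (c + e) := Nat.mul_le_mul_right _ h4
    nlinarith

/-- A sum of `n`-th roots of unity lies in the field generated by a primitive one. -/
lemma ll_mem (n : ℕ) (hn : 0 < n) (ξ : ℂ) (hξ : IsPrimitiveRoot ξ n) (x : Multiset ℂ)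
    (hx : ∀ z ∈ x, z ^ n = 1) : x.sum ∈ IntermediateField.adjoin ℚ {ξ} := by
  have : NeZero n := ⟨hn.ne'⟩
  refine multiset_sum_mem _ fun z hz => ?_
  obtain ⟨i, -, rfl⟩ := hξ.eq_pow_of_pow_eq_one (hx z hz)
  exact pow_mem (IntermediateField.mem_adjoin_simple_self _ _) _

lemma ll_one (x : Multiset ℂ) (hx : ∀ z ∈ x, z ^ 1 = 1) : x.sum = x.card := by
  have : x = Multiset.replicate x.card 1 :=
    Multiset.eq_replicate.2 ⟨rfl, fun z hz => by simpa using hx z hz⟩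
  rw [this]; simp

lemma ll_main (S : AddSubmonoid ℕ) (p q : ℕ) (hpq : p < q) (n : ℕ) (hn : 0 < n)
    (hS : ∀ r, r.Prime → r ∣ n → r ∈ S ∧ (r = p ∨ q ≤ r)) (x y : Multiset ℂ)
    (hx : ∀ z ∈ x, z ^ n = 1) (hy : ∀ z ∈ y, z ^ n = 1) (hxy : x.sum = y.sum) :
    (∃ s ∈ S, x.card = y.card + s) ∨ (p - y.card) * (q - 1) ≤ x.card := by
  classical
  induction n using Nat.strong_induction_on generalizing x y with
  | _ n ih =>
  by_cases hn1 : n = 1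
  · subst hn1
    rw [ll_one x hx, ll_one y hy] at hxy
    exact Or.inl ⟨0, S.zero_mem, by exact_mod_cast hxy⟩
  by_cases hyp : p ≤ y.card
  · right
    rw [Nat.sub_eq_zero_of_le hyp]; simp
  push Not at hyp
  -- choose the prime
  obtain ⟨P, hPp, hPn, hPe⟩ : ∃ P, P.Prime ∧ P ∣ n ∧
      (P = p → ∀ r, r.Prime → r ∣ n → r = p) := by
    by_cases h : ∃ r, r.Prime ∧ r ∣ n ∧ r ≠ p
    · obtain ⟨r, h1, h2, h3⟩ := h
      exact ⟨r, h1, h2, fun h => absurd h h3⟩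
    · push Not at h
      obtain ⟨r, h1, h2⟩ := Nat.exists_prime_and_dvd hn1
      exact ⟨r, h1, h2, fun _ => h⟩
  obtain ⟨m, rfl⟩ := hPn
  rw [mul_comm P m] at *
  have hm : 0 < m := Nat.pos_of_mul_pos_right hn
  have hPS : P ∈ S := (hS P hPp (Dvd.intro_left m rfl)).1
  have hpP : p ≤ P := by
    rcases (hS P hPp (Dvd.intro_left m rfl)).2 with h | h <;> omega
  have hmlt : m < m * P := by
    have := hPp.two_le
    nlinarith
  have IH := ih m hmlt hm (fun r hr hd => hS r hr (hd.mul_right P))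
  set ξ : ℂ := Complex.exp (2 * Real.pi * Complex.I / m)
  have hξ : IsPrimitiveRoot ξ m := Complex.isPrimitiveRoot_exp m hm.ne'
  by_cases hdvd : P ∣ m
  · -- the ramified case
    obtain ⟨ζ, hζ⟩ : ∃ ζ : ℂ, IsPrimitiveRoot ζ (m * P) :=
      ⟨_, Complex.isPrimitiveRoot_exp _ hn.ne'⟩
    have hζm : IsPrimitiveRoot (ζ ^ m) P := hζ.pow hn rfl
    obtain ⟨X, hX, hXc, hXs⟩ := ll_decomp m P hm.ne' hPp.pos ζ hζm x hx
    obtain ⟨Y, hY, hYc, hYs⟩ := ll_decomp m P hm.ne' hPp.pos ζ hζm y hy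
    have hdeg := ll_degree m (m * P) hm hn ξ ζ ζ hξ hζ (hζ.isIntegral hn).tower_top ⟨0, by simp⟩
    rw [mul_comm m P, Nat.totient_mul_of_prime_of_dvd hPp hdvd, mul_comm P] at hdeg
    have hdeg' := Nat.le_of_mul_le_mul_left hdeg (Nat.totient_pos.2 hm)
    have hz := ll_indep _ ζ P hdeg' (fun j => (X j).sum - (Y j).sum)
      (fun j => sub_mem (ll_mem m hm ξ hξ _ (hX j)) (ll_mem m hm ξ hξ _ (hY j)))
      (by simp only [mul_sub, Finset.sum_sub_distrib]; rw [← hXs, ← hYs, hxy, sub_self])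
    by_cases hall : ∀ j < P, ∃ s ∈ S, (X j).card = (Y j).card + s
    · left
      choose! s hs1 hs2 using hall
      refine ⟨∑ j ∈ Finset.range P, s j, S.sum_mem fun j hj => hs1 j (Finset.mem_range.1 hj), ?_⟩
      rw [hXc, hYc, ← Finset.sum_add_distrib]
      exact Finset.sum_congr rfl fun j hj => hs2 j (Finset.mem_range.1 hj)
    · right
      push Not at hall
      obtain ⟨j, hj, hjs⟩ := hall
      rcases IH (X j) (Y j) (hX j) (hY j) (sub_eq_zero.1 (hz j hj)) with ⟨s, h1, h2⟩ | h
      · exact absurd h2 (hjs s h1)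
      · have hxj : (X j).card ≤ x.card := by
          rw [hXc]
          exact Finset.single_le_sum (f := fun j => (X j).card) (fun _ _ => Nat.zero_le _)
            (Finset.mem_range.2 hj)
        have hyj : (Y j).card ≤ y.card := by
          rw [hYc]
          exact Finset.single_le_sum (f := fun j => (Y j).card) (fun _ _ => Nat.zero_le _)
            (Finset.mem_range.2 hj)
        exact le_trans (Nat.mul_le_mul_right _ (by omega)) (h.trans hxj)
  · -- the unramified case
    have hcop : Nat.Coprime m P := ((Nat.Prime.coprime_iff_not_dvd hPp).2 hdvd).symm
    obtain ⟨ζ, hζ⟩ : ∃ ζ : ℂ, IsPrimitiveRoot ζ P :=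
      ⟨_, Complex.isPrimitiveRoot_exp _ hPp.ne_zero⟩
    have hζm : IsPrimitiveRoot (ζ ^ m) P := hζ.pow_of_coprime m hcop
    have hθ : IsPrimitiveRoot (ξ * ζ) (m * P) := by
      rw [IsPrimitiveRoot.iff_orderOf, (Commute.all ξ ζ).orderOf_mul_eq_mul_orderOf_of_coprime]
      · rw [← hξ.eq_orderOf, ← hζ.eq_orderOf]
      · rw [← hξ.eq_orderOf, ← hζ.eq_orderOf]; exact hcop
    obtain ⟨X, hX, hXc, hXs⟩ := ll_decomp m P hm.ne' hPp.pos ζ hζm x hx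
    obtain ⟨Y, hY, hYc, hYs⟩ := ll_decomp m P hm.ne' hPp.pos ζ hζm y hy
    have hdeg := ll_degree m (m * P) hm hn ξ ζ (ξ * ζ) hξ hθ
      (hζ.isIntegral hPp.pos).tower_top ⟨1, by simp⟩
    rw [mul_comm m P, Nat.totient_mul_of_prime_of_not_dvd hPp hdvd, mul_comm (P - 1)] at hdeg
    have hdeg' := Nat.le_of_mul_le_mul_left hdeg (Nat.totient_pos.2 hm)
    set D : ℕ → ℂ := fun j => (X j).sum - (Y j).sum with hD
    have hDm : ∀ j, D j ∈ IntermediateField.adjoin ℚ {ξ} :=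
      fun j => sub_mem (ll_mem m hm ξ hξ _ (hX j)) (ll_mem m hm ξ hξ _ (hY j))
    have hD0 : ∑ j ∈ Finset.range P, ζ ^ j * D j = 0 := by
      simp only [hD, mul_sub, Finset.sum_sub_distrib]
      rw [← hXs, ← hYs, hxy, sub_self]
    have hD1 : ∑ j ∈ Finset.range P, ζ ^ j * (D j - D (P - 1)) = 0 := by
      simp only [mul_sub, Finset.sum_sub_distrib]
      rw [hD0, ← Finset.sum_mul, hζ.geom_sum_eq_zero hPp.one_lt]
      simp
    have hD2 : ∑ j ∈ Finset.range (P - 1), ζ ^ j * (D j - D (P - 1)) = 0 := by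
      have h := Finset.sum_range_succ (fun j => ζ ^ j * (D j - D (P - 1))) (P - 1)
      rw [Nat.sub_add_cancel hPp.one_lt.le, hD1] at h
      simpa using h.symm
    have hz := ll_indep _ ζ (P - 1) hdeg' (fun j => D j - D (P - 1))
      (fun j => sub_mem (hDm j) (hDm _)) hD2
    have hDc : ∀ j < P, D j = D (P - 1) := by
      intro j hj
      by_cases h : j = P - 1
      · rw [h]
      · exact sub_eq_zero.1 (hz j (by omega))
    -- the set of empty classes of `y`
    have hne : ((Finset.range P).filter fun j => (Y j).card = 0).Nonempty := by
      by_contra hemp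
      rw [Finset.not_nonempty_iff_eq_empty, Finset.filter_eq_empty_iff] at hemp
      have : ∑ j ∈ Finset.range P, 1 ≤ ∑ j ∈ Finset.range P, (Y j).card :=
        Finset.sum_le_sum fun j hj => Nat.one_le_iff_ne_zero.2 (hemp hj)
      rw [← hYc] at this
      simp at this
      omega
    obtain ⟨j0, hj0, hmin⟩ := Finset.exists_min_image _ (fun j => (X j).card) hne
    simp only [Finset.mem_filter, Finset.mem_range] at hj0 hmin
    obtain ⟨hj0P, hj0Y⟩ := hj0
    set u := (X j0).card with hu
    have hsumeq : ∀ j < P, (X j).sum = (Y j + X j0).sum := by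
      intro j hj
      have h1 := (hDc j hj).trans (hDc j0 hj0P).symm
      simp only [hD] at h1
      rw [Multiset.card_eq_zero.1 hj0Y] at h1
      simp only [Multiset.sum_zero, sub_zero] at h1
      rw [Multiset.sum_add, ← h1]; ring
    have hroot : ∀ j, ∀ z ∈ Y j + X j0, z ^ m = 1 := by
      intro j z hz
      rcases Multiset.mem_add.1 hz with h | h
      · exact hY _ _ h
      · exact hX _ _ h
    by_cases hall : ∀ j < P, ∃ s ∈ S, (X j).card = (Y j).card + u + s
    · left
      choose! s hs1 hs2 using hall
      refine ⟨P * u + ∑ j ∈ Finset.range P, s j, S.add_mem ?_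
        (S.sum_mem fun j hj => hs1 j (Finset.mem_range.1 hj)), ?_⟩
      · rw [mul_comm, ← smul_eq_mul]; exact S.nsmul_mem hPS u
      · rw [hXc, hYc, Finset.sum_congr rfl fun j hj => hs2 j (Finset.mem_range.1 hj),
          Finset.sum_add_distrib, Finset.sum_add_distrib]
        simp
        ring
    · right
      push Not at hall
      obtain ⟨j, hj, hjs⟩ := hall
      have hqP : q ≤ P := by
        rcases (hS P hPp (Dvd.intro_left m rfl)).2 with h | h
        · exfalso
          have hm1 : m = 1 := by
            by_contra hne1
            obtain ⟨r, hr, hrm⟩ := Nat.exists_prime_and_dvd hne1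
            have := hPe h r hr (hrm.mul_right P)
            rw [← h] at this
            exact hdvd (this ▸ hrm)
          subst hm1
          have h2 := hsumeq j hj
          rw [ll_one _ (hX j), ll_one _ (hroot j)] at h2
          refine hjs 0 S.zero_mem ?_
          rw [add_zero, hu, ← Multiset.card_add]
          exact_mod_cast h2
        · exact h
      have hfj : (p - ((Y j).card + u)) * (q - 1) ≤ (X j).card := by
        rcases IH (X j) (Y j + X j0) (hX j) (hroot j) (hsumeq j hj) with ⟨s, h1, h2⟩ | h
        · rw [Multiset.card_add] at h2
          exact absurd h2 (hjs s h1)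
        · rwa [Multiset.card_add] at h
      rw [← Finset.add_sum_erase _ _ (Finset.mem_range.2 hj)] at hXc hYc
      have hF : u * (P - 1) ≤ ∑ i ∈ (Finset.range P).erase j, (X i).card +
          u * ∑ i ∈ (Finset.range P).erase j, (Y i).card := by
        rw [Finset.mul_sum, ← Finset.sum_add_distrib]
        have hc : ((Finset.range P).erase j).card = P - 1 := by
          rw [Finset.card_erase_of_mem (Finset.mem_range.2 hj), Finset.card_range]
        rw [← hc, mul_comm, ← smul_eq_mul]
        refine Finset.card_nsmul_le_sum _ _ _ fun i hi => ?_
        have hi' := Finset.mem_range.1 (Finset.mem_of_mem_erase hi)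
        by_cases h0 : (Y i).card = 0
        · have := hmin i ⟨hi', h0⟩
          omega
        · have : u * 1 ≤ u * (Y i).card := Nat.mul_le_mul_left _ (Nat.one_le_iff_ne_zero.2 h0)
          omega
      have := ll_arith p q P _ _ _ _ u hpq hqP (by rw [add_comm, ← hYc]; exact hyp) hF hfj
      rw [hXc]
      rwa [add_comm (∑ i ∈ (Finset.range P).erase j, (Y i).card), ← hYc] at this

/-- (Lam–Leung) If `N ≥ 1` roots of unity of order dividing `l` sum to zero, then `N`
is a nonnegative integer combination of the prime factors of `l`. -/
theorem lam_leung (l N : ℕ) (hl : 1 ≤ l) (hN : 1 ≤ N)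
    (lam : Fin N → ℂ) (hroots : ∀ i, lam i ^ l = 1)
    (hsum : ∑ i, lam i = 0) :
    ∃ c : ℕ → ℕ, N = ∑ p ∈ l.primeFactors, c p * p := by
  classical
  let S : AddSubmonoid ℕ :=
    { carrier := {k | ∃ c : ℕ → ℕ, k = ∑ p ∈ l.primeFactors, c p * p}
      zero_mem' := ⟨fun _ => 0, by simp⟩
      add_mem' := by
        rintro a b ⟨c, rfl⟩ ⟨d, rfl⟩
        exact ⟨fun p => c p + d p, by simp [add_mul, Finset.sum_add_distrib]⟩ }
  change N ∈ S
  have hmemS : ∀ r, r.Prime → r ∣ l → r ∈ S := by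
    intro r hr hd
    refine ⟨fun p => if p = r then 1 else 0, ?_⟩
    have : r ∈ l.primeFactors := Nat.mem_primeFactors.2 ⟨hr, hd, by omega⟩
    simp only [ite_mul, one_mul, zero_mul, Finset.sum_ite_eq', if_pos this]
  set x : Multiset ℂ := Finset.univ.val.map lam with hxdef
  have hxc : x.card = N := by simp [hxdef]
  have hxs : x.sum = (0 : Multiset ℂ).sum := by rw [Multiset.sum_zero]; exact hsum
  have hx : ∀ z ∈ x, z ^ l = 1 := by
    intro z hz
    obtain ⟨i, -, rfl⟩ := Multiset.mem_map.1 hz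
    exact hroots i
  by_cases hl1 : l = 1
  · subst hl1
    rw [ll_one x hx, hxc] at hxs
    simp at hxs
    omega
  set p := l.minFac with hp
  have hpp : p.Prime := Nat.minFac_prime hl1
  have hpl : p ∣ l := Nat.minFac_dvd l
  by_cases hex : ∃ r, r.Prime ∧ r ∣ l ∧ r ≠ p
  · set q := Nat.find hex with hq
    obtain ⟨hqp, hql, hqne⟩ := Nat.find_spec hex
    have hpq : p < q := lt_of_le_of_ne (Nat.minFac_le_of_dvd hqp.two_le hql) (Ne.symm hqne)
    rcases ll_main S p q hpq l hl (fun r hr hd => ⟨hmemS r hr hd, by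
        by_cases h : r = p
        · exact Or.inl h
        · exact Or.inr (Nat.find_min' hex ⟨hr, hd, h⟩)⟩) x 0 hx (by simp) hxs with ⟨s, h1, h2⟩ | h
    · rw [hxc] at h2
      simp at h2
      rwa [h2]
    · rw [hxc] at h
      simp only [Multiset.card_zero, Nat.sub_zero] at h
      have hcop : Nat.gcd p q = 1 := (Nat.coprime_primes hpp hqp).2 (Ne.symm hqne)
      obtain ⟨a, b, hab⟩ := Nat.exists_add_mul_eq_of_gcd_dvd_of_mul_pred_le p q N
        (by rw [hcop]; exact one_dvd _)
        (le_trans (Nat.mul_le_mul_right _ (Nat.pred_le _)) h)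
      rw [← hab]
      exact S.add_mem (S.nsmul_mem (hmemS p hpp hpl) a) (S.nsmul_mem (hmemS q hqp hql) b)
  · push Not at hex
    rcases ll_main S p (p + N + 2) (by omega) l hl
      (fun r hr hd => ⟨hmemS r hr hd, Or.inl (hex r hr hd)⟩) x 0 hx (by simp) hxs
      with ⟨s, h1, h2⟩ | h
    · rw [hxc] at h2
      simp at h2
      rwa [h2]
    · rw [hxc] at h
      simp only [Multiset.card_zero, Nat.sub_zero] at h
      have := hpp.one_lt
      exfalso
      have h3 : 1 * (p + N + 2 - 1) ≤ p * (p + N + 2 - 1) := Nat.mul_le_mul_right _ (by omega)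
      omega
end

section
/- Let l be a prime, w = e^{2πi/l}, and let a_0, …, a_{l−1} be natural numbers indexed by ℤ/lℤ with Σ_i a_i = N. Then the Turyn equation Σ_{i,k ∈ ℤ/lℤ} w^k a_i a_{i+k} = N holds if and only if for every k ∈ ℤ/lℤ with k ≠ 0 one has Σ_{i ∈ ℤ/lℤ} (a_i − a_{i+k})² = 2N, all indices taken modulo l. In particular for l = 2 the Turyn equation is equivalent to (a_0 − a_1)² = N. -/
/-- The Turyn equation for counts `a : ZMod l → ℕ`. -/
def TurynEq (l N : ℕ) [NeZero l] (a : ZMod l → ℕ) : Prop :=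
  ∑ i : ZMod l, ∑ k : ZMod l,
    Complex.exp (2 * Real.pi * Complex.I / l) ^ k.val * (a i : ℂ) * (a (i + k) : ℂ) = (N : ℂ)

open Polynomial in
theorem key_aux (l : ℕ) (hl : l.Prime) (w : ℂ) (hw : IsPrimitiveRoot w l) (f : ℕ → ℤ)
    (h : ∑ k ∈ Finset.range l, (f k : ℂ) * w ^ k = 0) :
    ∀ k < l, f k = f (l - 1) := by
  have hg : ∑ k ∈ Finset.range l, w ^ k = 0 := hw.geom_sum_eq_zero hl.one_lt
  set Q : ℤ[X] := ∑ k ∈ Finset.range (l - 1), C (f k - f (l - 1)) * X ^ k with hQ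
  have hlt : l = (l - 1) + 1 := by have := hl.pos; omega
  have hroot : aeval w Q = 0 := by
    have h2 : ∑ k ∈ Finset.range l, ((f k : ℂ) - f (l - 1)) * w ^ k = 0 := by
      simp only [sub_mul, Finset.sum_sub_distrib, ← Finset.mul_sum, h, hg]; simp
    rw [hlt, Finset.sum_range_succ, ← hlt] at h2
    simpa [hQ, map_sum] using h2
  have hdeg : Q.degree < (l - 1 : ℕ) := by
    have := hl.two_le
    refine (Polynomial.degree_sum_le _ _).trans_lt ?_
    rw [Finset.sup_lt_iff (by exact WithBot.bot_lt_coe _)]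
    intro k hk
    refine (degree_C_mul_X_pow_le _ _).trans_lt ?_
    exact_mod_cast Finset.mem_range.1 hk
  have hdvd : cyclotomic l ℤ ∣ Q := by
    rw [cyclotomic_eq_minpoly hw hl.pos]
    exact minpoly.isIntegrallyClosed_dvd (hw.isIntegral hl.pos) hroot
  have hQ0 : Q = 0 := by
    by_contra hne
    refine absurd (degree_le_of_dvd hdvd hne) (not_le.2 ?_)
    rw [degree_cyclotomic, Nat.totient_prime hl]; exact hdeg
  intro k hk
  rcases Nat.lt_or_ge k (l - 1) with hk' | hk'
  · have := congrArg (fun p => coeff p k) hQ0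
    simp only [hQ, finsetSum_coeff, coeff_C_mul, coeff_X_pow, coeff_zero, mul_ite, mul_one, mul_zero,
      Finset.sum_ite_eq, Finset.mem_range, hk', if_true] at this
    omega
  · rw [show k = l - 1 by omega]

theorem sum_zmod_aux (l : ℕ) [NeZero l] (g : ZMod l → ℂ) (w : ℂ) :
    ∑ k : ZMod l, g k * w ^ k.val = ∑ k ∈ Finset.range l, g (k : ZMod l) * w ^ k := by
  refine Finset.sum_bij (fun k _ => k.val) ?_ ?_ ?_ ?_
  · intro k _; exact Finset.mem_range.2 (ZMod.val_lt k)
  · intro a _ b _ h; exact ZMod.val_injective l h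
  · intro b hb; exact ⟨b, Finset.mem_univ _, ZMod.val_cast_of_lt (Finset.mem_range.1 hb)⟩
  · intro k _; simp

theorem key_zmod (l : ℕ) (hl : l.Prime) [NeZero l] (w : ℂ) (hw : IsPrimitiveRoot w l)
    (b : ZMod l → ℤ) :
    ∑ k : ZMod l, (b k : ℂ) * w ^ k.val = 0 ↔ ∀ k, b k = b 0 := by
  have e := sum_zmod_aux l (fun k => (b k : ℂ)) w
  rw [e]
  constructor
  · intro h k
    have := key_aux l hl w hw (fun n => b n) h
    have h1 := this k.val (ZMod.val_lt k)
    have h0 := this 0 hl.pos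
    simp at h1 h0
    rw [h1, h0]
  · intro h
    simp only [h, ← Finset.mul_sum, hw.geom_sum_eq_zero hl.one_lt, mul_zero]

theorem sq_aux (l : ℕ) [NeZero l] (a : ZMod l → ℕ) (k : ZMod l) :
    ∑ i : ZMod l, ((a i : ℤ) - (a (i + k) : ℤ)) ^ 2
      = 2 * ∑ i : ZMod l, (a i : ℤ) * a (i + 0) - 2 * ∑ i : ZMod l, (a i : ℤ) * a (i + k) := by
  have h : ∑ i : ZMod l, (a (i + k) : ℤ) * a (i + k) = ∑ i : ZMod l, (a i : ℤ) * a i :=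
    Equiv.sum_comp (Equiv.addRight k) (fun i => (a i : ℤ) * a i)
  have : ∀ i, ((a i : ℤ) - (a (i + k) : ℤ)) ^ 2
      = (a i : ℤ) * a i + (a (i + k) : ℤ) * a (i + k) - 2 * ((a i : ℤ) * a (i + k)) := by
    intro i; ring
  simp only [this, Finset.sum_sub_distrib, Finset.sum_add_distrib, h, ← Finset.mul_sum, add_zero]
  ring

theorem turyn_main (l N : ℕ) (hl : l.Prime) [NeZero l] (a : ZMod l → ℕ) :
    TurynEq l N a ↔
      ∀ k : ZMod l, k ≠ 0 → ∑ i : ZMod l, ((a i : ℤ) - (a (i + k) : ℤ)) ^ 2 = 2 * N := by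
  have hw : IsPrimitiveRoot (Complex.exp (2 * Real.pi * Complex.I / l)) l :=
    Complex.isPrimitiveRoot_exp l hl.ne_zero
  have key := key_zmod l hl _ hw
    (fun k => ∑ i : ZMod l, (a i : ℤ) * a (i + k) - if k = 0 then (N : ℤ) else 0)
  unfold TurynEq
  generalize Complex.exp (2 * Real.pi * Complex.I / l) = w at *
  have e : ∑ i : ZMod l, ∑ k : ZMod l, w ^ k.val * (a i : ℂ) * (a (i + k) : ℂ) = (N : ℂ) ↔
      ∑ k : ZMod l, (((∑ i : ZMod l, (a i : ℤ) * a (i + k) - if k = 0 then (N : ℤ) else 0 : ℤ)) : ℂ)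
        * w ^ k.val = 0 := by
    rw [Finset.sum_comm, ← sub_eq_zero]
    have : ∀ k : ZMod l, (((∑ i : ZMod l, (a i : ℤ) * a (i + k)
          - if k = 0 then (N : ℤ) else 0 : ℤ)) : ℂ) * w ^ k.val
        = ∑ i : ZMod l, w ^ k.val * (a i : ℂ) * (a (i + k) : ℂ) - if k = 0 then (N : ℂ) else 0 := by
      intro k
      push_cast
      rw [sub_mul, Finset.sum_mul]
      congr 1
      · exact Finset.sum_congr rfl fun i _ => by ring
      · split_ifs with hk <;> simp [hk]
    simp only [this, Finset.sum_sub_distrib]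
    simp
  rw [e]
  refine key.trans (forall_congr' fun k => ?_)
  rw [sq_aux]
  by_cases hk : k = 0
  · simp [hk]
  · simp only [hk, if_false, if_true, ne_eq, not_false_eq_true, forall_true_left]
    omega

/-- For `l` prime, the Turyn equation is equivalent to `∑ i (a_i - a_{i+k})² = 2N`
for every `k ≠ 0`; for `l = 2` it is equivalent to `(a₀ - a₁)² = N`. -/
theorem turyn_equation_prime (l N : ℕ) (hl : l.Prime) [NeZero l]
    (a : ZMod l → ℕ) (hsum : ∑ i : ZMod l, a i = N) :
    (TurynEq l N a ↔
      ∀ k : ZMod l, k ≠ 0 → ∑ i : ZMod l, ((a i : ℤ) - (a (i + k) : ℤ)) ^ 2 = 2 * N) ∧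
    (l = 2 → (TurynEq l N a ↔ ((a 0 : ℤ) - (a 1 : ℤ)) ^ 2 = N)) := by
  refine ⟨turyn_main l N hl a, ?_⟩
  intro h2
  rw [turyn_main l N hl a]
  subst h2
  have hs : ∑ i : ZMod 2, ((a i : ℤ) - (a (i + 1) : ℤ)) ^ 2 = 2 * ((a 0 : ℤ) - a 1) ^ 2 := by
    have : ∀ g : ZMod 2 → ℤ, ∑ i : ZMod 2, g i = g 0 + g 1 := fun g => Fin.sum_univ_two g
    rw [this, zero_add, show (1 + 1 : ZMod 2) = 0 from rfl]
    ring
  constructor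
  · intro h
    have := h 1 (by decide)
    rw [hs] at this
    linarith
  · intro h k hk
    have : k = 1 := by revert k; decide
    rw [this, hs, h]
end

section
/- Let N ≥ 1 and regard Φ as a smooth function of the angles (α_0, …, α_{N−1}) ∈ ℝ^N via q_j = e^{iα_j}. Then (α_0, …, α_{N−1}) is a critical point of Φ (all partial derivatives ∂Φ/∂α_i vanish) if and only if Φ_i(q) is a real number for every i ∈ ℤ/Nℤ. -/
/-- `Φ(q) = ∑_{i+k=j+l} q_i q_k / (q_j q_l)`, indices in `ℤ/Nℤ`. -/
noncomputable def Phi (N : ℕ) [NeZero N] (q : ZMod N → ℂ) : ℂ :=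
  ∑ i : ZMod N, ∑ j : ZMod N, ∑ k : ZMod N, ∑ l : ZMod N,
    if i + k = j + l then q i * q k / (q j * q l) else 0

/-- `Φ_i(q) = ∑_{i+k=j+l} q_i q_k / (q_j q_l)` with the index `i` fixed. -/
noncomputable def PhiPart (N : ℕ) [NeZero N] (q : ZMod N → ℂ) (i : ZMod N) : ℂ :=
  ∑ j : ZMod N, ∑ k : ZMod N, ∑ l : ZMod N,
    if i + k = j + l then q i * q k / (q j * q l) else 0

lemma term_eq (a b c d : ℝ) :
    Complex.exp (a * Complex.I) * Complex.exp (b * Complex.I) /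
      (Complex.exp (c * Complex.I) * Complex.exp (d * Complex.I)) =
    Complex.exp (((a + b - c - d : ℝ) : ℂ) * Complex.I) := by
  rw [← Complex.exp_add, ← Complex.exp_add, ← Complex.exp_sub]
  congr 1
  push_cast
  ring

lemma Phi_re (N : ℕ) [NeZero N] (β : ZMod N → ℝ) :
    (Phi N (fun j => Complex.exp ((β j : ℝ) * Complex.I))).re =
    ∑ i : ZMod N, ∑ j : ZMod N, ∑ k : ZMod N, ∑ l : ZMod N,
      if i + k = j + l then Real.cos (β i + β k - β j - β l) else 0 := by
  simp only [Phi, term_eq, Complex.re_sum, apply_ite Complex.re, Complex.exp_ofReal_mul_I_re,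
    Complex.zero_re]

/-- The summand of the imaginary part of `Φ`. -/
noncomputable def sinTerm (N : ℕ) [NeZero N] (β : ZMod N → ℝ) (i j k l : ZMod N) : ℝ :=
  if i + k = j + l then Real.sin (β i + β k - β j - β l) else 0

lemma PhiPart_im (N : ℕ) [NeZero N] (β : ZMod N → ℝ) (i : ZMod N) :
    (PhiPart N (fun j => Complex.exp ((β j : ℝ) * Complex.I)) i).im =
    ∑ j : ZMod N, ∑ k : ZMod N, ∑ l : ZMod N, sinTerm N β i j k l := by
  simp only [PhiPart, term_eq, Complex.im_sum, apply_ite Complex.im, Complex.exp_ofReal_mul_I_im,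
    Complex.zero_im, sinTerm]

lemma sinTerm_swap (N : ℕ) [NeZero N] (β : ZMod N → ℝ) (i j k l : ZMod N) :
    sinTerm N β k j i l = sinTerm N β i j k l := by
  unfold sinTerm
  rw [add_comm k i, add_comm (β k) (β i)]

lemma sinTerm_neg (N : ℕ) [NeZero N] (β : ZMod N → ℝ) (i j k l : ZMod N) :
    sinTerm N β j i l k = - sinTerm N β i j k l := by
  unfold sinTerm
  by_cases h : i + k = j + l
  · rw [if_pos h, if_pos h.symm, ← Real.sin_neg]
    congr 1
    ring
  · rw [if_neg h, if_neg (fun h' => h h'.symm), neg_zero]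

/-- Coefficient of the partial derivative. -/
noncomputable def dl (N : ℕ) (m i : ZMod N) : ℝ := if i = m then 1 else 0

lemma sum_dl (N : ℕ) [NeZero N] (m : ZMod N) (f : ZMod N → ℝ) :
    ∑ i, dl N m i * f i = f m := by
  simp [dl]

lemma hasDeriv_upd (N : ℕ) [NeZero N] (α : ZMod N → ℝ) (m i : ZMod N) :
    HasDerivAt (fun t : ℝ => Function.update α m t i) (dl N m i) (α m) := by
  unfold dl
  by_cases h : i = m
  · subst h
    simpa using hasDerivAt_id' (α i)
  · simpa [h] using hasDerivAt_const (α m) (α i)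

lemma hasDeriv_Phi (N : ℕ) [NeZero N] (α : ZMod N → ℝ) (m : ZMod N) :
    HasDerivAt (fun t : ℝ =>
        (Phi N (fun j => Complex.exp ((Function.update α m t j : ℝ) * Complex.I))).re)
      (∑ i : ZMod N, ∑ j : ZMod N, ∑ k : ZMod N, ∑ l : ZMod N,
        -(sinTerm N α i j k l * (dl N m i + dl N m k - dl N m j - dl N m l))) (α m) := by
  simp only [Phi_re]
  refine HasDerivAt.fun_sum fun i _ => HasDerivAt.fun_sum fun j _ => HasDerivAt.fun_sum fun k _ =>
    HasDerivAt.fun_sum fun l _ => ?_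
  unfold sinTerm
  by_cases h : i + k = j + l
  · simp only [if_pos h]
    have := ((((hasDeriv_upd N α m i).fun_add (hasDeriv_upd N α m k)).fun_sub
      (hasDeriv_upd N α m j)).fun_sub (hasDeriv_upd N α m l)).cos
    simpa using this
  · simp only [if_neg h]
    simpa using hasDerivAt_const (α m) (0 : ℝ)

lemma sum_eq (N : ℕ) [NeZero N] (α : ZMod N → ℝ) (m : ZMod N) :
    (∑ i : ZMod N, ∑ j : ZMod N, ∑ k : ZMod N, ∑ l : ZMod N,
        -(sinTerm N α i j k l * (dl N m i + dl N m k - dl N m j - dl N m l))) =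
    -4 * ∑ j : ZMod N, ∑ k : ZMod N, ∑ l : ZMod N, sinTerm N α m j k l := by
  have h1 : ∑ i : ZMod N, ∑ j : ZMod N, ∑ k : ZMod N, ∑ l : ZMod N,
      dl N m i * sinTerm N α i j k l =
      ∑ j : ZMod N, ∑ k : ZMod N, ∑ l : ZMod N, sinTerm N α m j k l := by
    simp only [← Finset.mul_sum]
    rw [sum_dl]
  have h2 : ∑ i : ZMod N, ∑ j : ZMod N, ∑ k : ZMod N, ∑ l : ZMod N,
      dl N m k * sinTerm N α i j k l =
      ∑ j : ZMod N, ∑ k : ZMod N, ∑ l : ZMod N, sinTerm N α m j k l := by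
    simp only [← Finset.mul_sum, sum_dl]
    rw [Finset.sum_comm]
    simp only [sinTerm_swap N α m]
  have h3 : ∑ i : ZMod N, ∑ j : ZMod N, ∑ k : ZMod N, ∑ l : ZMod N,
      dl N m j * sinTerm N α i j k l =
      - ∑ j : ZMod N, ∑ k : ZMod N, ∑ l : ZMod N, sinTerm N α m j k l := by
    simp only [← Finset.mul_sum, sum_dl]
    rw [← Finset.sum_neg_distrib]
    refine Finset.sum_congr rfl fun i _ => ?_
    rw [Finset.sum_comm, ← Finset.sum_neg_distrib]
    refine Finset.sum_congr rfl fun k _ => ?_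
    rw [← Finset.sum_neg_distrib]
    exact Finset.sum_congr rfl fun l _ => sinTerm_neg N α m i k l
  have h4 : ∑ i : ZMod N, ∑ j : ZMod N, ∑ k : ZMod N, ∑ l : ZMod N,
      dl N m l * sinTerm N α i j k l =
      - ∑ j : ZMod N, ∑ k : ZMod N, ∑ l : ZMod N, sinTerm N α m j k l := by
    simp only [sum_dl]
    rw [← Finset.sum_neg_distrib]
    refine Finset.sum_congr rfl fun i _ => ?_
    rw [← Finset.sum_neg_distrib]
    refine Finset.sum_congr rfl fun j _ => ?_
    rw [← Finset.sum_neg_distrib]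
    refine Finset.sum_congr rfl fun k _ => ?_
    rw [sinTerm_neg N α j i m k, sinTerm_swap N α j i m k]
  have e : ∀ i j k l : ZMod N,
      -(sinTerm N α i j k l * (dl N m i + dl N m k - dl N m j - dl N m l)) =
      dl N m j * sinTerm N α i j k l + dl N m l * sinTerm N α i j k l
       - dl N m i * sinTerm N α i j k l - dl N m k * sinTerm N α i j k l := by
    intros
    ring
  simp only [e, Finset.sum_add_distrib, Finset.sum_sub_distrib]
  rw [h1, h2, h3, h4]
  ring

/-- `(α_0,…,α_{N-1})` is a critical point of `Φ` (viewed as a function of the angles, via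
`q_j = e^{iα_j}`) if and only if every `Φ_i(q)` is real. -/
theorem Phi_critical_iff (N : ℕ) [NeZero N] (hN : 1 ≤ N) (α : ZMod N → ℝ) :
    (∀ i : ZMod N,
      deriv (fun t : ℝ =>
        (Phi N (fun j => Complex.exp ((Function.update α i t j : ℝ) * Complex.I))).re)
        (α i) = 0) ↔
    (∀ i : ZMod N, (PhiPart N (fun j => Complex.exp ((α j : ℝ) * Complex.I)) i).im = 0) := by
  refine forall_congr' fun i => ?_
  rw [(hasDeriv_Phi N α i).deriv, sum_eq, PhiPart_im]
  simp
end

section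
/- Let N ≥ 1 and p ≥ 1. Then ∫_{𝕋^N} Φ(q)^p dq equals the number of quadruples of p-tuples ((i_1,…,i_p), (j_1,…,j_p), (k_1,…,k_p), (l_1,…,l_p)) of elements of ℤ/Nℤ such that i_s + k_s = j_s + l_s in ℤ/Nℤ for every s = 1,…,p, and the multiset {i_1, k_1, …, i_p, k_p} equals the multiset {j_1, l_1, …, j_p, l_p}. -/
open MeasureTheory

lemma aux_prod {N : ℕ} [NeZero N] (q : ZMod N → ℂ) (A : Multiset (ZMod N)) :
    (A.map q).prod = ∏ n, q n ^ (A.count n) := by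
  rw [Finset.prod_multiset_map_count]
  apply Finset.prod_subset (Finset.subset_univ _)
  intro x _ hx
  rw [Multiset.mem_toFinset] at hx
  rw [Multiset.count_eq_zero_of_notMem hx, pow_zero]

lemma aux_int (c : ℤ) :
    ∫ a in Set.Icc (0 : ℝ) 1, Complex.exp (2 * Real.pi * a * Complex.I) ^ c =
      if c = 0 then 1 else 0 := by
  split_ifs with h
  · subst h
    simp
  · rw [MeasureTheory.integral_Icc_eq_integral_Ioc,
      ← intervalIntegral.integral_of_le zero_le_one]
    have hc : (2 * Real.pi * Complex.I * c : ℂ) ≠ 0 := by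
      have : (c : ℂ) ≠ 0 := by exact_mod_cast h
      exact mul_ne_zero Complex.two_pi_I_ne_zero this
    have : ∀ a : ℝ, Complex.exp (2 * Real.pi * a * Complex.I) ^ c =
        Complex.exp ((2 * Real.pi * Complex.I * c) * a) := by
      intro a
      rw [← Complex.exp_int_mul]
      congr 1
      ring
    simp_rw [this]
    rw [integral_exp_mul_complex hc]
    have h1 : Complex.exp (2 * Real.pi * Complex.I * c) = 1 := by
      rw [mul_comm]
      exact Complex.exp_int_mul_two_pi_mul_I c
    simp [h1]

lemma aux_term {N p : ℕ} [NeZero N] (q : ZMod N → ℂ) (hq : ∀ n, q n ≠ 0)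
    (i j k l : Fin p → ZMod N) :
    ∏ s, (q (i s) * q (k s) / (q (j s) * q (l s))) =
      ∏ n, q n ^ (((Multiset.map i Finset.univ.val + Multiset.map k Finset.univ.val).count n : ℤ) -
        ((Multiset.map j Finset.univ.val + Multiset.map l Finset.univ.val).count n : ℤ)) := by
  have e : ∀ f : Fin p → ZMod N,
      ∏ s, q (f s) = ((Multiset.map f Finset.univ.val).map q).prod := by
    intro f
    rw [Multiset.map_map]
    rfl
  rw [Finset.prod_div_distrib, Finset.prod_mul_distrib, Finset.prod_mul_distrib,
    e, e, e, e, ← Multiset.prod_add, ← Multiset.prod_add, ← Multiset.map_add,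
    ← Multiset.map_add, aux_prod, aux_prod, ← Finset.prod_div_distrib]
  refine Finset.prod_congr rfl fun n _ => ?_
  rw [zpow_sub₀ (hq n), zpow_natCast, zpow_natCast]

lemma aux_main {N p : ℕ} [NeZero N] (i j k l : Fin p → ZMod N) :
    (∫ α : ZMod N → ℝ in Set.univ.pi (fun _ => Set.Icc (0 : ℝ) 1),
      ∏ s, ((fun n => Complex.exp (2 * Real.pi * (α n) * Complex.I)) (i s) *
        (fun n => Complex.exp (2 * Real.pi * (α n) * Complex.I)) (k s) /
        ((fun n => Complex.exp (2 * Real.pi * (α n) * Complex.I)) (j s) *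
        (fun n => Complex.exp (2 * Real.pi * (α n) * Complex.I)) (l s)))) =
    if Multiset.map i Finset.univ.val + Multiset.map k Finset.univ.val =
          Multiset.map j Finset.univ.val + Multiset.map l Finset.univ.val then 1 else 0 := by
  have h0 : ∀ α : ZMod N → ℝ, _ := fun α => aux_term
    (fun n => Complex.exp (2 * Real.pi * (α n) * Complex.I)) (fun n => Complex.exp_ne_zero _) i j k l
  simp_rw [h0]
  rw [volume_pi, Measure.restrict_pi_pi]
  rw [integral_fintype_prod_eq_prod (𝕜 := ℂ) (f := fun n (a : ℝ) =>
    Complex.exp (2 * Real.pi * a * Complex.I) ^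
      (((Multiset.map i Finset.univ.val + Multiset.map k Finset.univ.val).count n : ℤ) -
        ((Multiset.map j Finset.univ.val + Multiset.map l Finset.univ.val).count n : ℤ)))]
  simp_rw [aux_int]
  rw [Finset.prod_ite_zero]
  simp only [Finset.prod_const_one, Finset.mem_univ, true_imp_iff]
  refine if_congr ?_ rfl rfl
  rw [Multiset.ext]
  refine forall_congr' fun n => ?_
  rw [sub_eq_zero, Nat.cast_inj]

lemma Phi_pow {N : ℕ} (p : ℕ) [NeZero N] (q : ZMod N → ℂ) :
    Phi N q ^ p = ∑ T : Fin p → ZMod N × ZMod N × ZMod N × ZMod N,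
      if ∀ s, (T s).1 + (T s).2.2.1 = (T s).2.1 + (T s).2.2.2 then
        ∏ s, (q (T s).1 * q (T s).2.2.1 / (q (T s).2.1 * q (T s).2.2.2)) else 0 := by
  have : Phi N q = ∑ t : ZMod N × ZMod N × ZMod N × ZMod N,
      if t.1 + t.2.2.1 = t.2.1 + t.2.2.2 then
        q t.1 * q t.2.2.1 / (q t.2.1 * q t.2.2.2) else 0 := by
    simp only [Phi, Fintype.sum_prod_type]
  rw [this, Fintype.sum_pow]
  refine Finset.sum_congr rfl fun T _ => ?_
  rw [Finset.prod_ite_zero]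
  simp

/-- Tuples of quadruples versus quadruples of tuples. -/
def tupEquiv (p : ℕ) (Z : Type) : (Fin p → Z × Z × Z × Z) ≃
    (Fin p → Z) × (Fin p → Z) × (Fin p → Z) × (Fin p → Z) where
  toFun T := (fun s => (T s).1, fun s => (T s).2.1, fun s => (T s).2.2.1, fun s => (T s).2.2.2)
  invFun T := fun s => (T.1 s, T.2.1 s, T.2.2.1 s, T.2.2.2 s)
  left_inv _ := rfl
  right_inv _ := rfl

/-- The `p`-th moment of `Φ` over the torus `𝕋^N` counts the quadruples of `p`-tuples
`(i, j, k, l)` with `i_s + k_s = j_s + l_s` for all `s` and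
`[i_1 k_1 … i_p k_p] = [j_1 l_1 … j_p l_p]` as multisets. -/
theorem Phi_moments (N p : ℕ) [NeZero N] (hN : 1 ≤ N) (hp : 1 ≤ p) :
    (∫ α : ZMod N → ℝ in Set.univ.pi (fun _ => Set.Icc (0 : ℝ) 1),
        (Phi N (fun j => Complex.exp (2 * Real.pi * (α j) * Complex.I))) ^ p) =
      (Nat.card {T : (Fin p → ZMod N) × (Fin p → ZMod N) ×
          (Fin p → ZMod N) × (Fin p → ZMod N) //
        (∀ s, T.1 s + T.2.2.1 s = T.2.1 s + T.2.2.2 s) ∧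
        Multiset.map T.1 Finset.univ.val + Multiset.map T.2.2.1 Finset.univ.val =
          Multiset.map T.2.1 Finset.univ.val + Multiset.map T.2.2.2 Finset.univ.val} : ℂ) := by
  classical
  simp_rw [Phi_pow]
  rw [integral_finset_sum]
  · rw [Nat.card_eq_fintype_card, Fintype.card_subtype, Finset.card_filter, Nat.cast_sum,
      ← (tupEquiv p (ZMod N)).sum_comp]
    refine Finset.sum_congr rfl fun T _ => ?_
    by_cases h : ∀ s, (T s).1 + (T s).2.2.1 = (T s).2.1 + (T s).2.2.2
    · simp only [if_pos h]
      refine (aux_main (fun s => (T s).1) (fun s => (T s).2.1) (fun s => (T s).2.2.1)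
        (fun s => (T s).2.2.2)).trans ?_
      rw [Nat.cast_ite, Nat.cast_one, Nat.cast_zero]
      refine if_congr ?_ rfl rfl
      exact ⟨fun h' => ⟨h, h'⟩, fun h' => h'.2⟩
    · simp only [if_neg h]
      rw [if_neg (fun h' => h h'.1)]
      simp
  · intro T _
    refine ContinuousOn.integrableOn_compact (isCompact_univ_pi fun _ => isCompact_Icc) ?_
    apply Continuous.continuousOn
    split_ifs
    · refine continuous_finset_prod _ fun s _ => ?_
      refine Continuous.div (by fun_prop) (by fun_prop) fun α => ?_
      exact mul_ne_zero (Complex.exp_ne_zero _) (Complex.exp_ne_zero _)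
    · exact continuous_const
end
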